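/- arXiv:math/0008200 — 2 statements merged into one kernel-verified Lean document; each statement's English description precedes it below -/
import Mathlib

section
/- Let k be a field, n a natural number, and R = k[x_1, …, x_n] the polynomial ring in n variables over k. Let M be a finite free R-module, let N ⊆ M be an R-submodule which is free as an R-module, and let ξ ∈ M. Then the ideal I(ξ) = {a ∈ R : a·ξ ∈ N} of R is a principal ideal. -/
/-!
STATEMENT 0 (Chang–Skjelbred, cf. §4.3 of Braden–MacPherson,
"From moment graphs to intersection cohomology"):

Let `k` be a field, `n : ℕ`, and `R = k[x_1, …, x_n]` the polynomial ring in `n`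
variables over `k`.  Let `M` be a finite free `R`-module, `N ⊆ M` an `R`-submodule
which is free as an `R`-module, and `ξ ∈ M`.  Then the ideal
`I(ξ) = {a ∈ R : a • ξ ∈ N}` of `R` is principal.
-/

/-- In a GCD domain, the elements that carry a given element of a torsion-free module into a free
submodule form a principal ideal. -/
theorem Submodule.isPrincipal_comap_toSpanSingleton_of_free
    {R M : Type*} [CommRing R] [IsDomain R] [StrongNormalizedGCDMonoid R]
    [AddCommGroup M] [Module R M] [Module.IsTorsionFree R M]
    (N : Submodule R M) [Module.Free R N] (ξ : M) :
    (N.comap (LinearMap.toSpanSingleton R M ξ)).IsPrincipal := by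
  by_cases h : N.comap (LinearMap.toSpanSingleton R M ξ) = ⊥
  · rw [h]
    infer_instance
  obtain ⟨d, hd, hd0⟩ := Submodule.exists_mem_ne_zero_of_ne_bot h
  have hdN : d • ξ ∈ N := hd
  let b := Module.Free.chooseBasis R N
  let c := b.repr ⟨d • ξ, hdN⟩
  have mem_iff (a : R) : a • ξ ∈ N ↔ ∀ i, d ∣ a * c i := by
    constructor
    · intro ha i
      refine ⟨b.repr ⟨a • ξ, ha⟩ i, ?_⟩
      have key : a • (⟨d • ξ, hdN⟩ : N) = d • (⟨a • ξ, ha⟩ : N) :=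
        Subtype.ext (smul_comm a d ξ)
      simpa only [map_smul, Finsupp.smul_apply, smul_eq_mul] using
        congrArg (fun x => b.repr x i) key
    · intro ha
      choose m hm using ha
      have hsupp : ∀ i, m i ≠ 0 → i ∈ c.support := by
        intro i hi
        rw [Finsupp.mem_support_iff]
        intro hc
        exact mul_ne_zero hd0 hi (by rw [← hm, hc, mul_zero])
      let x : N := b.repr.symm (Finsupp.onFinset c.support m hsupp)
      have key : a • (⟨d • ξ, hdN⟩ : N) = d • x := by
        apply b.repr.injective
        ext i
        simpa only [x, map_smul, Finsupp.smul_apply, smul_eq_mul, LinearEquiv.apply_symm_apply,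
          Finsupp.onFinset_apply] using hm i
      have hx : d • (a • ξ) = d • (x : M) := by
        rw [smul_comm]
        exact congrArg Subtype.val key
      rw [smul_right_injective M hd0 hx]
      exact x.2
  let g := c.support.gcd c
  have dvd_iff (a : R) : (∀ i, d ∣ a * c i) ↔ d ∣ a * g := by
    rw [← (Associated.mul_right (normalize_associated a) g).dvd_iff_dvd_right,
      ← Finset.gcd_mul_left, Finset.dvd_gcd_iff]
    refine ⟨fun h i _ => h i, fun h i => ?_⟩
    by_cases hi : i ∈ c.support
    · exact h i hi
    · simp [Finsupp.notMem_support_iff.mp hi]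
  obtain ⟨q, hq⟩ := gcd_dvd_left d g
  have he : gcd d g ≠ 0 := fun h0 => hd0 ((gcd_eq_zero_iff _ _).mp h0).1
  refine ⟨q, Submodule.ext fun a => ?_⟩
  rw [Submodule.mem_comap, LinearMap.toSpanSingleton_apply, mem_iff, dvd_iff,
    ← Ideal.span, Ideal.mem_span_singleton]
  calc d ∣ a * g ↔ d ∣ gcd (a * d) (a * g) := by
        rw [dvd_gcd_iff, and_iff_right (dvd_mul_left d a)]
    _ ↔ d ∣ a * gcd d g := (gcd_mul_left' a d g).dvd_iff_dvd_right
    _ ↔ gcd d g * q ∣ gcd d g * a := by rw [← hq, mul_comm a]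
    _ ↔ q ∣ a := mul_dvd_mul_iff_left he

theorem changSkjelbred_principal
    (k : Type*) [Field k] (n : ℕ)
    (M : Type*) [AddCommGroup M] [Module (MvPolynomial (Fin n) k) M]
    [Module.Finite (MvPolynomial (Fin n) k) M]
    [Module.Free (MvPolynomial (Fin n) k) M]
    (N : Submodule (MvPolynomial (Fin n) k) M)
    [Module.Free (MvPolynomial (Fin n) k) N]
    (ξ : M) :
    Submodule.IsPrincipal
      (N.comap (LinearMap.toSpanSingleton (MvPolynomial (Fin n) k) M ξ)) := by
  let : StrongNormalizationMonoid (MvPolynomial (Fin n) k) :=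
    UniqueFactorizationMonoid.strongNormalizationMonoid
  let := UniqueFactorizationMonoid.toStrongNormalizedGCDMonoid (MvPolynomial (Fin n) k)
  exact N.isPrincipal_comap_toSpanSingleton_of_free ξ
end

section
/- Let Γ be a 𝔱-moment graph and suppose there is an injective map μ : 𝒱 → 𝔱* such that for every edge L with endpoints z and w, the vector μ(z) − μ(w) is a nonzero element of the direction V_L. Then Γ is flexible at every vertex x: for every sub-vector space H ⊆ 𝔱* and every vertex y ≠ x lying in Γ^H (the connected component containing x of the subgraph of Γ with all vertices but only those edges L with V_L ⊆ H), there exists an assignment ζ of a vector ζ_z ∈ 𝔱* to each vertex z of Γ^H such that ζ_x = 0, ζ_y ≠ 0, ζ_z ∈ H for every vertex z of Γ^H, and ζ_z − ζ_w ∈ V_L for every edge L of Γ^H with endpoints z and w. -/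
/-!
STATEMENT 7 (Proposition 4.8 "flexible" of Braden–MacPherson):

A 𝔱-moment graph admitting an injective map μ : 𝒱 → 𝔱* with
μ(up L) − μ(down L) a nonzero element of the direction V_L for every edge L
is flexible at every vertex.
-/

noncomputable section

/-- A `𝔱`-moment graph, with directions in the dual space `W = 𝔱*`
(a finite-dimensional complex vector space).  Each edge joins two distinct
comparable vertices; we record it with its lower endpoint `down L` and upper
endpoint `up L` (so `down L < up L`), and its direction, a one-dimensional
subspace `dir L ⊆ 𝔱*`. -/
structure MomentGraph (W : Type) [AddCommGroup W] [Module ℂ W] where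
  /-- the (finite) set of vertices -/
  V : Type
  /-- the (finite) set of edges -/
  E : Type
  [finV : Finite V]
  [finE : Finite E]
  /-- the partial order on the vertices -/
  [ord : PartialOrder V]
  /-- the lower endpoint of an edge -/
  down : E → V
  /-- the upper endpoint of an edge -/
  up : E → V
  down_lt_up : ∀ L, down L < up L
  /-- the direction of an edge: a one-dimensional subspace of `𝔱*` -/
  dir : E → Submodule ℂ W
  dir_rank : ∀ L, Module.finrank ℂ ↥(dir L) = 1

attribute [instance] MomentGraph.finV MomentGraph.finE MomentGraph.ord

variable {W : Type} [AddCommGroup W] [Module ℂ W] [FiniteDimensional ℂ W]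

/-- Two vertices are adjacent in the subgraph `Γ^H` (all vertices, but only the
edges `L` with `V_L ⊆ H`) if some edge with direction contained in `H` joins
them. -/
def MomentGraph.adjIn (Γ : MomentGraph W) (H : Submodule ℂ W) (y z : Γ.V) : Prop :=
  ∃ L : Γ.E, Γ.dir L ≤ H ∧
    ((Γ.down L = y ∧ Γ.up L = z) ∨ (Γ.down L = z ∧ Γ.up L = y))

/-- `y` belongs to `Γ^H`, the connected component containing `x` of the subgraph
of `Γ` with all vertices but only those edges `L` with `V_L ⊆ H`. -/
def MomentGraph.inCompH (Γ : MomentGraph W) (H : Submodule ℂ W) (x y : Γ.V) : Prop :=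
  Relation.ReflTransGen (Γ.adjIn H) x y

/-- A potential `μ` whose differences along edges lie in the edge directions varies only within `H`
on the component `Γ^H`. -/
theorem MomentGraph.inCompH.sub_mem {W : Type} [AddCommGroup W] [Module ℂ W]
    {Γ : MomentGraph W} {μ : Γ.V → W}
    (hμ : ∀ L : Γ.E, μ (Γ.up L) - μ (Γ.down L) ∈ Γ.dir L) {H : Submodule ℂ W} {x z : Γ.V}
    (h : Γ.inCompH H x z) : μ z - μ x ∈ H := by
  induction h with
  | refl => simp
  | tail _ hbc ih =>
    rw [← sub_add_sub_cancel]
    refine H.add_mem ?_ ih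
    obtain ⟨L, hL, ⟨rfl, rfl⟩ | ⟨rfl, rfl⟩⟩ := hbc
    · exact hL (hμ L)
    · exact sub_mem_comm_iff.mp (hL (hμ L))

theorem momentGraph_flexible
    (Γ : MomentGraph W) (μ : Γ.V → W) (hμinj : Function.Injective μ)
    (hμ : ∀ L : Γ.E, μ (Γ.up L) - μ (Γ.down L) ∈ Γ.dir L ∧ μ (Γ.up L) - μ (Γ.down L) ≠ 0) :
    -- `Γ` is flexible at every vertex `x`:
    ∀ (x : Γ.V) (H : Submodule ℂ W) (y : Γ.V), Γ.inCompH H x y → y ≠ x →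
      ∃ ζ : Γ.V → W,
        ζ x = 0 ∧
        ζ y ≠ 0 ∧
        (∀ z : Γ.V, Γ.inCompH H x z → ζ z ∈ H) ∧
        (∀ L : Γ.E, Γ.dir L ≤ H → Γ.inCompH H x (Γ.down L) → Γ.inCompH H x (Γ.up L) →
          ζ (Γ.up L) - ζ (Γ.down L) ∈ Γ.dir L) := by
  intro x H y _ hyx
  refine ⟨fun z => μ z - μ x, sub_self _, sub_ne_zero.mpr (hμinj.ne hyx),
    fun z hz => hz.sub_mem fun L => (hμ L).1, fun L _ _ _ => ?_⟩
  simpa using (hμ L).1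
end
end
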